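/- For any permutations σ and τ of Z_n and any positions k, j ∈ Z_n, the extension operation does not decrease Hamming distance: hd(ext_k(σ), ext_j(τ)) ≥ hd(σ, τ). (Equivalently, extending two permutations of Z_n to permutations of Z_{n+1} by inserting the new symbol n at positions k and j respectively creates at most one new agreement between them.) -/

import Mathlib

/-- Extend a permutation of `Fin n` to a permutation of `Fin (n+1)` fixing the new
last element `n`. -/
def extFix {n : ℕ} (σ : Equiv.Perm (Fin n)) : Equiv.Perm (Fin (n + 1)) :=
  σ.viaFintypeEmbedding ⟨Fin.castSucc, Fin.castSucc_injective n⟩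

/-- The extension `ext_k(σ)` of a permutation `σ` of `Z_n` by position `k`:
it sends `k ↦ n`, `n ↦ σ k`, and `j ↦ σ j` for every other `j < n`. -/
def extPerm {n : ℕ} (σ : Equiv.Perm (Fin n)) (k : Fin n) : Equiv.Perm (Fin (n + 1)) :=
  Equiv.swap (Fin.castSucc (σ k)) (Fin.last n) * extFix σ

theorem extFix_castSucc {n : ℕ} (σ : Equiv.Perm (Fin n)) (x : Fin n) :
    extFix σ x.castSucc = (σ x).castSucc :=
  Equiv.Perm.viaFintypeEmbedding_apply_image σ ⟨Fin.castSucc, Fin.castSucc_injective n⟩ x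

theorem extFix_last {n : ℕ} (σ : Equiv.Perm (Fin n)) :
    extFix σ (Fin.last n) = Fin.last n := by
  apply Equiv.Perm.viaFintypeEmbedding_apply_notMem_range
  rintro ⟨x, hx⟩
  exact Fin.castSucc_ne_last x hx

theorem extPerm_last {n : ℕ} (σ : Equiv.Perm (Fin n)) (k : Fin n) :
    extPerm σ k (Fin.last n) = (σ k).castSucc := by
  simp [extPerm, extFix_last]

theorem extPerm_castSucc {n : ℕ} (σ : Equiv.Perm (Fin n)) (k x : Fin n) :
    extPerm σ k x.castSucc = if x = k then Fin.last n else (σ x).castSucc := by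
  split_ifs with h
  · simp [extPerm, extFix_castSucc, h]
  · rw [extPerm, Equiv.Perm.mul_apply, extFix_castSucc]
    apply Equiv.swap_apply_of_ne_of_ne
    · simpa using h
    · exact Fin.castSucc_ne_last _

/-- For any permutations `σ, τ` of `Z_n` and positions `k, j`, the extension operation
does not decrease the Hamming distance: `hd(ext_k(σ), ext_j(τ)) ≥ hd(σ, τ)`. -/
theorem hammingDist_extPerm_ge {n : ℕ} (σ τ : Equiv.Perm (Fin n)) (k j : Fin n) :
    hammingDist ⇑σ ⇑τ ≤ hammingDist ⇑(extPerm σ k) ⇑(extPerm τ j) := by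
  unfold hammingDist
  apply Finset.card_le_card_of_injOn
    (fun x => if x = k ∧ x = j then Fin.last n else x.castSucc)
  · intro x hx
    have hx : σ x ≠ τ x := by simpa using hx
    simp only [Finset.coe_filter, Finset.mem_univ, true_and, Set.mem_ofPred_eq]
    by_cases h : x = k ∧ x = j
    · obtain ⟨rfl, rfl⟩ := h
      simpa [extPerm_last] using hx
    · rw [if_neg h, extPerm_castSucc, extPerm_castSucc]
      split_ifs with hk hj
      · exact absurd ⟨hk, hj⟩ h
      · exact (Fin.castSucc_ne_last _).symm
      · exact Fin.castSucc_ne_last _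
      · simpa using hx
  · intro x _ y _ hxy
    dsimp only at hxy
    split_ifs at hxy with hx hy hy
    · exact hx.1.trans hy.1.symm
    · exact absurd hxy.symm (Fin.castSucc_ne_last _)
    · exact absurd hxy (Fin.castSucc_ne_last _)
    · exact Fin.castSucc_injective n hxy
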